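/- Let Ω be the Gromov boundary of the free group F₂ acting by left concatenation. For every Borel probability measure ν on Ω there exists a sequence g_n ∈ F₂ and a point ω ∈ Ω such that g_n ν → δ_ω in the weak* topology; i.e. the system (Ω, F₂) is strongly proximal. -/

import Mathlib

open MeasureTheory

/-- The boundary of the free group `F₂` on two generators (encoded as `FreeGroup Bool`):
one-sided infinite reduced words in the four letters `(g, ±) : Bool × Bool`, with
the product (cylinder) topology. -/
abbrev OmegaF2 : Type :=
  {ω : ℕ → Bool × Bool // ∀ i : ℕ, ω (i + 1) ≠ ((ω i).1, !(ω i).2)}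

instance : MeasurableSpace OmegaF2 := borel OmegaF2
instance : BorelSpace OmegaF2 := ⟨rfl⟩

/-- If `g` prepends the letter `(x, true)` to every word on which no cancellation occurs, then
`g ^ n` maps such words to words starting with `n` letters `(x, true)`. -/
theorem OmegaF2.val_pow_smul [MulAction (FreeGroup Bool) OmegaF2] {g : FreeGroup Bool} {x : Bool}
    (hg : ∀ ω : OmegaF2, ω.val 0 ≠ (x, false) →
      (g • ω).val 0 = (x, true) ∧ ∀ j, (g • ω).val (j + 1) = ω.val j)
    {ω : OmegaF2} (hω : ω.val 0 ≠ (x, false)) (n : ℕ) :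
    (g ^ n • ω).val 0 ≠ (x, false) ∧ ∀ i < n, (g ^ n • ω).val i = (x, true) := by
  induction n with
  | zero => simpa using hω
  | succ n ih =>
    rw [pow_succ', mul_smul]
    obtain ⟨h0, hsucc⟩ := hg _ ih.1
    refine ⟨by simp [h0], fun i hi => ?_⟩
    cases i with
    | zero => exact h0
    | succ j => rw [hsucc, ih.2 j (by omega)]

/-- Neighbourhoods of a boundary point contain a cylinder around it. -/
theorem OmegaF2.exists_cylinder_subset {G : Set OmegaF2} (hG : IsOpen G) {ω : OmegaF2}
    (hω : ω ∈ G) : ∃ m : ℕ, ∀ η : OmegaF2, (∀ i < m, η.val i = ω.val i) → η ∈ G := by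
  obtain ⟨U, hU, rfl⟩ := isOpen_induced_iff.1 hG
  obtain ⟨I, u, hu, hIU⟩ := isOpen_pi_iff.1 hU ω.val hω
  refine ⟨I.sup id + 1, fun η hη => hIU fun i hi => ?_⟩
  rw [hη i (Nat.lt_succ_of_le (Finset.le_sup (f := id) hi))]
  exact (hu i hi).2

/-- A sequence of probability measures whose mass concentrates in every neighbourhood of a point
converges to the Dirac mass there. -/
theorem MeasureTheory.ProbabilityMeasure.tendsto_dirac_of_forall_isOpen {X : Type*}
    [TopologicalSpace X] [MeasurableSpace X] [OpensMeasurableSpace X] [HasOuterApproxClosed X]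
    {μ : ℕ → ProbabilityMeasure X} {x : X}
    (h : ∀ G : Set X, IsOpen G → x ∈ G →
      Filter.Tendsto (fun n => (μ n : Measure X) G) Filter.atTop (nhds 1)) :
    Filter.Tendsto μ Filter.atTop (nhds ⟨Measure.dirac x, inferInstance⟩) := by
  refine tendsto_of_forall_isOpen_le_liminf' fun G hG => ?_
  by_cases hx : x ∈ G
  · rw [(h G hG hx).liminf_eq]
    exact prob_le_one (μ := Measure.dirac x)
  · simp [Measure.dirac_apply' x hG.measurableSet, hx]

/-- The boundary action of `F₂` on `Ω` (left
concatenation-with-cancellation) is strongly proximal: for every Borel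
probability measure `ν` on `Ω` there are `gₙ ∈ F₂` and `ω ∈ Ω` with
`gₙν → δ_ω` in the weak* topology. -/
theorem stmt12 [MulAction (FreeGroup Bool) OmegaF2]
    (haction : ∀ (x : Bool) (ω : OmegaF2),
      (FreeGroup.of x • ω : OmegaF2).val =
        if ω.val 0 = (x, false)
        then fun i => ω.val (i + 1)
        else fun i => match i with
          | 0 => (x, true)
          | j + 1 => ω.val j)
    (hcont : ∀ g : FreeGroup Bool, Continuous fun ω : OmegaF2 => g • ω)
    (ν : ProbabilityMeasure OmegaF2) :
    ∃ (g : ℕ → FreeGroup Bool) (ω : OmegaF2),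
      Filter.Tendsto
        (fun n : ℕ => ν.map ((hcont (g n)).measurable.aemeasurable))
        Filter.atTop
        (nhds ⟨Measure.dirac ω, inferInstance⟩) := by
  have hcons : ∀ (x : Bool) (ω : OmegaF2), ω.val 0 ≠ (x, false) →
      (FreeGroup.of x • ω).val 0 = (x, true) ∧
        ∀ j, (FreeGroup.of x • ω).val (j + 1) = ω.val j := by
    intro x ω hω
    rw [haction, if_neg hω]
    exact ⟨rfl, fun _ => rfl⟩
  let a : FreeGroup Bool := FreeGroup.of true
  let b : FreeGroup Bool := FreeGroup.of false
  let ω : OmegaF2 := ⟨fun _ => (true, true), by simp⟩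
  let B : Set OmegaF2 := {η | η.val 0 = (true, false)}
  have hB : MeasurableSet B := by
    have : Continuous fun η : OmegaF2 => η.val 0 := (continuous_apply 0).comp continuous_subtype_val
    exact ((isClosed_singleton (x := ((true, false) : Bool × Bool))).preimage this).measurableSet
  let E : ℕ → Set OmegaF2 := fun k => (fun η : OmegaF2 => (b ^ k)⁻¹ • η) ⁻¹' B
  have hE : ∀ k, MeasurableSet (E k) := fun k => (hcont _).measurable hB
  have hlt : ∀ j k, j < k → Disjoint (E j) (E k) := by
    intro j k hjk
    refine Set.disjoint_left.2 fun η (hj : _ = _) (hk : _ = _) => ?_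
    have h := (OmegaF2.val_pow_smul (g := b) (hcons false) (ω := (b ^ k)⁻¹ • η)
      (by rw [hk]; simp) (k - j)).2 0 (by omega)
    have hpow : b ^ (k - j) * (b ^ k)⁻¹ = (b ^ j)⁻¹ := by
      rw [pow_sub b hjk.le, mul_assoc]
      group
    rw [← mul_smul, hpow, hj] at h
    simp at h
  have hdisj : Pairwise (Function.onFun Disjoint E) := fun j k hjk =>
    hjk.lt_or_gt.elim (hlt j k) fun h => (hlt k j h).symm
  have hlim : Filter.Tendsto (fun k => (ν : Measure OmegaF2) (E k)) Filter.atTop (nhds 0) := by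
    refine ENNReal.tendsto_atTop_zero_of_tsum_ne_top ?_
    rw [← measure_iUnion hdisj hE]
    exact measure_ne_top _ _
  have : TopologicalSpace.PseudoMetrizableSpace OmegaF2 :=
    Topology.IsInducing.subtypeVal.pseudoMetrizableSpace
  refine ⟨fun n => a ^ n * (b ^ n)⁻¹, ω,
    ProbabilityMeasure.tendsto_dirac_of_forall_isOpen fun G hG hω => ?_⟩
  obtain ⟨m, hm⟩ := OmegaF2.exists_cylinder_subset hG hω
  have hlim_sub := ENNReal.Tendsto.sub (tendsto_const_nhds (x := (1 : ENNReal))) hlim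
    (Or.inl ENNReal.one_ne_top)
  rw [tsub_zero] at hlim_sub
  refine tendsto_of_tendsto_of_tendsto_of_le_of_le' hlim_sub tendsto_const_nhds ?_
    (Filter.Eventually.of_forall fun n => prob_le_one)
  filter_upwards [Filter.eventually_ge_atTop m] with n hn
  rw [← prob_compl_eq_one_sub (hE n), ProbabilityMeasure.toMeasure_map,
    Measure.map_apply (hcont _).measurable hG.measurableSet]
  refine measure_mono fun η hη => hm _ fun i hi => ?_
  beta_reduce
  rw [mul_smul]
  exact (OmegaF2.val_pow_smul (hcons true) hη n).2 i (by omega)
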